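/- Let H be a complex Hilbert space, P0 an orthogonal projection, f0 a unit vector with P0 f0 = f0, and let Z ∈ B₂(H) be anti-Hermitian and horizontal, i.e. (P0 − f0⊗f0) Z (P0 − f0⊗f0) = 0 and (1−P0) Z (1−P0) = 0. Then (1/2) ‖Z‖₂² ≤ ‖Z P0 − P0 Z‖₂² + ‖Z f0‖² ≤ (3/2) ‖Z‖₂². Consequently the quotient norm ‖·‖_q (= ‖Z‖₂ for the horizontal lift Z) and the ambient norm ‖·‖_a (= (‖Z P0 − P0 Z‖₂² + ‖Z f0‖²)^{1/2}) of a tangent vector satisfy (1/√2)‖·‖_q ≤ ‖·‖_a ≤ √(3/2) ‖·‖_q. -/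

import Mathlib

open scoped InnerProductSpace
open ContinuousLinearMap

/-- The rank-one operator `x ⊗ y`, with `(x ⊗ y) z = ⟨z, y⟩ x` (inner product linear in
the first variable); in Mathlib's convention this is `z ↦ ⟪y, z⟫ • x`. -/
noncomputable def rankOne {H : Type*} [NormedAddCommGroup H] [InnerProductSpace ℂ H]
    (x y : H) : H →L[ℂ] H :=
  (innerSL ℂ y).smulRight x

/-- The squared Hilbert–Schmidt norm `‖X‖₂²`, expressed via the Hilbert basis `e`. -/
noncomputable def hsNormSq {H : Type*} [NormedAddCommGroup H] [InnerProductSpace ℂ H]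
    [CompleteSpace H] {ι : Type*} (e : HilbertBasis ι ℂ H) (X : H →L[ℂ] H) : ℝ :=
  ∑' i, ‖X (e i)‖ ^ 2


section helpers

variable {H : Type*} [NormedAddCommGroup H] [InnerProductSpace ℂ H] [CompleteSpace H]
  {ι : Type*} (e : HilbertBasis ι ℂ H)

/-- Hilbert–Schmidt operators. -/
def IsHS (X : H →L[ℂ] H) : Prop := Summable fun i => ‖X (e i)‖ ^ 2

theorem parseval_hasSum (x : H) : HasSum (fun i => ‖⟪e i, x⟫_ℂ‖ ^ 2) (‖x‖ ^ 2) := by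
  have h := e.hasSum_inner_mul_inner x x
  have h2 := Complex.hasSum_re h
  have h3 : Complex.re ⟪x, x⟫_ℂ = ‖x‖ ^ 2 := by
    have := inner_self_eq_norm_sq (𝕜 := ℂ) x
    simpa using this
  rw [h3] at h2
  convert h2 using 1
  funext i
  rw [← inner_conj_symm x (e i), ← Complex.normSq_eq_conj_mul_self, Complex.ofReal_re,
    Complex.normSq_eq_norm_sq]

theorem hs_adj_aux {X : H →L[ℂ] H} (hX : IsHS e X) :
    HasSum (fun i => ‖(adjoint X) (e i)‖ ^ 2) (hsNormSq e X) := by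
  have key : ∀ i j, ‖⟪e j, X (e i)⟫_ℂ‖ ^ 2 = ‖⟪e i, adjoint X (e j)⟫_ℂ‖ ^ 2 := by
    intro i j
    rw [adjoint_inner_right, ← inner_conj_symm, RCLike.norm_conj]
  have hs : Summable (fun p : ι × ι => ‖⟪e p.2, X (e p.1)⟫_ℂ‖ ^ 2) := by
    rw [summable_prod_of_nonneg (fun p => by positivity)]
    refine ⟨fun i => (parseval_hasSum e (X (e i))).summable, ?_⟩
    simpa only [(parseval_hasSum e (X (e _))).tsum_eq] using (show Summable fun i => ‖X (e i)‖ ^ 2 from hX)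
  have hX' : HasSum (fun i => ‖X (e i)‖ ^ 2) (hsNormSq e X) := hX.hasSum
  have h1 : HasSum (fun p : ι × ι => ‖⟪e p.2, X (e p.1)⟫_ℂ‖ ^ 2) (hsNormSq e X) := by
    have := hs.hasSum.prod_fiberwise (fun i => parseval_hasSum e (X (e i)))
    rw [← this.unique hX']
    exact hs.hasSum
  have h2 := (Equiv.prodComm ι ι).hasSum_iff.mpr h1
  refine h2.prod_fiberwise (fun j => ?_)
  have := parseval_hasSum e (adjoint X (e j))
  simp only [← key] at this
  exact this

theorem IsHS.adj {X : H →L[ℂ] H} (hX : IsHS e X) : IsHS e (adjoint X) :=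
  (hs_adj_aux e hX).summable

theorem hs_adj {X : H →L[ℂ] H} (hX : IsHS e X) :
    hsNormSq e (adjoint X) = hsNormSq e X := (hs_adj_aux e hX).tsum_eq

theorem IsHS.left {X : H →L[ℂ] H} (hX : IsHS e X) (A : H →L[ℂ] H) : IsHS e (A * X) := by
  refine Summable.of_nonneg_of_le (fun i => by positivity) (fun i => ?_)
    (Summable.mul_left (‖A‖ ^ 2) hX)
  rw [← mul_pow]
  exact pow_le_pow_left₀ (norm_nonneg _) (A.le_opNorm _) 2

theorem IsHS.right {X : H →L[ℂ] H} (hX : IsHS e X) (A : H →L[ℂ] H) : IsHS e (X * A) := by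
  have := ((hX.adj e).left e (star A)).adj e
  rw [← star_eq_adjoint, ← star_eq_adjoint, ← star_mul, star_star] at this
  exact this

theorem proj_orth {P : H →L[ℂ] H} (hs : star P = P) (hi : P * P = P) (x y : H) :
    ⟪P x, (1 - P) y⟫_ℂ = 0 := by
  have : P ((1 - P) y) = 0 := by
    have : P * (1 - P) = 0 := by rw [mul_sub, hi, mul_one, sub_self]
    exact congrArg (fun T : H →L[ℂ] H => T y) this
  rw [← hs, star_eq_adjoint, adjoint_inner_left, ← star_eq_adjoint, hs, this, inner_zero_right]

theorem proj_pyth {P : H →L[ℂ] H} (hs : star P = P) (hi : P * P = P) (x y : H) :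
    ‖P x + (1 - P) y‖ ^ 2 = ‖P x‖ ^ 2 + ‖(1 - P) y‖ ^ 2 := by
  have := norm_add_sq_eq_norm_sq_add_norm_sq_of_inner_eq_zero _ _ (proj_orth hs hi x y)
  simpa only [sq] using this

theorem hs_left {X P : H →L[ℂ] H} (hX : IsHS e X) (hs : star P = P) (hi : P * P = P) :
    hsNormSq e X = hsNormSq e (P * X) + hsNormSq e ((1 - P) * X) := by
  unfold hsNormSq
  rw [← Summable.tsum_add (hX.left e P) (hX.left e (1 - P))]
  refine tsum_congr fun i => ?_
  have := proj_pyth hs hi (X (e i)) (X (e i))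
  rw [← add_apply, add_sub_cancel] at this
  exact this

theorem hs_right {X P : H →L[ℂ] H} (hX : IsHS e X) (hs : star P = P) (hi : P * P = P) :
    hsNormSq e X = hsNormSq e (X * P) + hsNormSq e (X * (1 - P)) := by
  rw [← hs_adj e hX, ← hs_adj e (hX.right e P), ← hs_adj e (hX.right e (1 - P)),
    hs_left e (hX.adj e) hs hi]
  simp only [← star_eq_adjoint, star_mul, star_sub, star_one, hs]

theorem hs_nonneg (X : H →L[ℂ] H) : 0 ≤ hsNormSq e X := tsum_nonneg fun i => by positivity

theorem hs_neg (X : H →L[ℂ] H) : hsNormSq e (-X) = hsNormSq e X := by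
  unfold hsNormSq; simp

theorem hs_zero : hsNormSq e (0 : H →L[ℂ] H) = 0 := by
  unfold hsNormSq; simp

theorem hs_rankOne (X : H →L[ℂ] H) (f : H) (hf : ‖f‖ = 1) :
    hsNormSq e (X * rankOne f f) = ‖X f‖ ^ 2 := by
  have h := (parseval_hasSum e f).mul_right (‖X f‖ ^ 2)
  rw [hf, one_pow, one_mul] at h
  rw [← h.tsum_eq]
  refine tsum_congr fun i => ?_
  have : (X * rankOne f f) (e i) = ⟪f, e i⟫_ℂ • X f := by
    simp [rankOne]
  rw [this, norm_smul, mul_pow, ← inner_conj_symm, RCLike.norm_conj]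

theorem rankOne_star (f : H) : star (rankOne f f) = rankOne f f := by
  rw [star_eq_adjoint]
  symm
  rw [eq_adjoint_iff]
  intro x y
  simp [rankOne, inner_smul_left, inner_smul_right, mul_comm]

theorem mul_rankOne_of_fix {A : H →L[ℂ] H} {f : H} (h : A f = f) :
    A * rankOne f f = rankOne f f := by
  ext x
  simp [rankOne, h]

end helpers

/-- For an anti-Hermitian Hilbert–Schmidt `Z` which is horizontal at
`(P0, f0)` (i.e. `(P0 − f0⊗f0) Z (P0 − f0⊗f0) = 0` and `(1−P0) Z (1−P0) = 0`) one has
`(1/2)‖Z‖₂² ≤ ‖Z P0 − P0 Z‖₂² + ‖Z f0‖² ≤ (3/2)‖Z‖₂²`; that is, the quotient and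
ambient norms of a tangent vector satisfy `(1/√2)‖·‖_q ≤ ‖·‖_a ≤ √(3/2)‖·‖_q`. -/
theorem quotient_ambient_norm_equivalence
    {H : Type*} [NormedAddCommGroup H] [InnerProductSpace ℂ H] [CompleteSpace H]
    {ι : Type*} (e : HilbertBasis ι ℂ H)
    (P0 : H →L[ℂ] H) (hP0sa : IsSelfAdjoint P0) (hP0idem : P0 * P0 = P0)
    (f0 : H) (hf0 : ‖f0‖ = 1) (hf0fix : P0 f0 = f0)
    (Z : H →L[ℂ] H) (hZhs : Summable fun i => ‖Z (e i)‖ ^ 2)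
    (hZah : adjoint Z = -Z)
    (hhor1 : (P0 - rankOne f0 f0) * Z * (P0 - rankOne f0 f0) = 0)
    (hhor2 : (1 - P0) * Z * (1 - P0) = 0) :
    (1 / 2) * hsNormSq e Z ≤ hsNormSq e (Z * P0 - P0 * Z) + ‖Z f0‖ ^ 2 ∧
    hsNormSq e (Z * P0 - P0 * Z) + ‖Z f0‖ ^ 2 ≤ (3 / 2) * hsNormSq e Z := by
  have hP : star P0 = P0 := hP0sa
  have hZs : star Z = -Z := hZah
  have hZ : IsHS e Z := hZhs
  set F := rankOne f0 f0 with hF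
  have hFs : star F = F := rankOne_star f0
  have hFf : F f0 = f0 := by
    simp [hF, rankOne, inner_self_eq_norm_sq_to_K, hf0]
  have hFF : F * F = F := mul_rankOne_of_fix hFf
  have hPF : P0 * F = F := mul_rankOne_of_fix hf0fix
  have hFP : F * P0 = F := by
    have := congrArg star hPF
    rwa [star_mul, hFs, hP] at this
  have hw : hsNormSq e (P0 * Z * (1 - P0)) = hsNormSq e ((1 - P0) * Z * P0) := by
    rw [← hs_adj e ((hZ.left e P0).right e (1 - P0)), ← hs_neg]
    congr 1
    simp only [← star_eq_adjoint, star_mul, star_sub, star_one, hP, hZs]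
    noncomm_ring
  have hZ1 := hs_right e hZ hP hP0idem
  have hZ2 := hs_left e (hZ.right e P0) hP hP0idem
  have hZ3 := hs_left e (hZ.right e (1 - P0)) hP hP0idem
  simp only [← mul_assoc] at hZ2 hZ3
  rw [hhor2, hs_zero, add_zero] at hZ3
  have hC : hsNormSq e (Z * P0 - P0 * Z)
      = hsNormSq e (P0 * Z * (1 - P0)) + hsNormSq e ((1 - P0) * Z * P0) := by
    have hCe : Z * P0 - P0 * Z = (1 - P0) * Z * P0 - P0 * Z * (1 - P0) := by noncomm_ring
    unfold hsNormSq
    rw [← Summable.tsum_add ((hZ.left e P0).right e (1 - P0))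
      ((hZ.left e (1 - P0)).right e P0)]
    refine tsum_congr fun i => ?_
    have := proj_pyth hP hP0idem (-(Z ((1 - P0) (e i)))) (Z (P0 (e i)))
    rw [map_neg, norm_neg] at this
    rw [hCe, sub_apply, sub_eq_neg_add]
    exact this
  have hu : ‖Z f0‖ ^ 2 = ‖P0 (Z f0)‖ ^ 2 + ‖(1 - P0) (Z f0)‖ ^ 2 := by
    have := proj_pyth hP hP0idem (Z f0) (Z f0)
    rwa [← add_apply, add_sub_cancel] at this
  have hc := hs_right e ((hZ.left e (1 - P0)).right e P0) hFs hFF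
  rw [mul_assoc _ P0 F, hPF, hF, hs_rankOne e _ f0 hf0, ← hF] at hc
  have hv := hs_right e ((hZ.left e P0).right e P0) hFs hFF
  rw [mul_assoc _ P0 F, hPF, hF, hs_rankOne e _ f0 hf0, ← hF] at hv
  have hQ : P0 * (1 - F) = P0 - F := by rw [mul_sub, mul_one, hPF]
  have hQ2 : (1 - F) * P0 = P0 - F := by rw [sub_mul, one_mul, hFP]
  rw [mul_assoc _ P0 (1 - F), hQ] at hv
  have hq : hsNormSq e (P0 * Z * (P0 - F)) = hsNormSq e ((P0 - F) * Z * P0) := by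
    rw [← hs_adj e ((hZ.left e P0).right e (P0 - F)), ← hs_neg]
    congr 1
    simp only [← star_eq_adjoint, star_mul, star_sub, hP, hFs, hZs]
    noncomm_ring
  have hq2 := hs_right e ((hZ.left e (P0 - F)).right e P0) hFs hFF
  rw [mul_assoc _ P0 F, hPF, hF, hs_rankOne e _ f0 hf0, ← hF, mul_assoc _ P0 (1 - F), hQ, hhor1,
    hs_zero, add_zero] at hq2
  have hb : ‖((P0 - F) * Z) f0‖ ^ 2 ≤ ‖P0 (Z f0)‖ ^ 2 := by
    have := proj_pyth hFs hFF (P0 (Z f0)) (P0 (Z f0))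
    rw [← add_apply, add_sub_cancel] at this
    rw [← hQ2]
    refine le_trans ?_ (ge_of_eq this)
    exact le_add_of_nonneg_left (by positivity)
  have n1 := hs_nonneg e ((1 - P0) * Z * P0 * (1 - F))
  have n2 := hs_nonneg e ((1 - P0) * Z * P0)
  have n3 := hs_nonneg e (P0 * Z * (P0 - F))
  have n4 : 0 ≤ ‖(1 - P0) (Z f0)‖ ^ 2 := by positivity
  have n5 : 0 ≤ ‖P0 (Z f0)‖ ^ 2 := by positivity
  have e1 : ((1 - P0) * Z) f0 = (1 - P0) (Z f0) := rfl
  have e2 : (P0 * Z) f0 = P0 (Z f0) := rfl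
  rw [e1] at hc
  rw [e2] at hv
  constructor <;> linarith
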